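/- Let E = (([A_i,B_i],l_i,η_i))_{i=1}^n be a non-vanishing extended multi-segment datum whose order satisfies (P′). Then the partial dual dual_k^− is applicable on E if and only if B_k = −1/2, l_k = 0, and B_j > −1/2 for every j > k. (The characterization of applicability of dual_k^− asserted after Definition 6.4 of the paper.) -/

import Mathlib

/-!
Common combinatorial setting for extended multi-segments (Moeglin-Atobe theory),
following Hazeltine-Liu-Lo, "On the intersection of local Arthur packets".
Rows of symbols are 0-indexed; row labels of labeled symbols are natural numbers.
-/

namespace LocalArthur

/-- A row `([A,B], l, eta)` of a symbol (an extended segment with the bound on `l` dropped). -/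
structure Row where
  A : ℚ
  B : ℚ
  l : ℚ
  eta : ℤ
deriving DecidableEq

/-- `a = A + B + 1`. -/
def Row.a (r : Row) : ℚ := r.A + r.B + 1

/-- `b = A - B + 1`. -/
def Row.b (r : Row) : ℚ := r.A - r.B + 1

/-- A rational number is an integer. -/
def IsInt (x : ℚ) : Prop := x.den = 1

instance (x : ℚ) : Decidable (IsInt x) := by unfold IsInt; infer_instance

/-- `(-1)^x` for an integer-valued rational `x` (junk value on non-integers). -/
def m1pow (x : ℚ) : ℤ := if x.num % 2 = 0 then 1 else -1

/-- Validity of a single row: `2A, 2B ∈ ℤ`, `A - B ∈ ℕ`, `l ∈ ℤ`, `eta = ±1`. -/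
def Row.IsES (r : Row) : Prop :=
  IsInt (2 * r.A) ∧ IsInt (2 * r.B) ∧ (∃ n : ℕ, r.A - r.B = (n : ℚ)) ∧
    IsInt r.l ∧ (r.eta = 1 ∨ r.eta = -1)

/-- The segment `[A,B]` of `r` is contained in that of `s`. -/
def Row.subseg (r s : Row) : Prop := s.B ≤ r.B ∧ r.A ≤ s.A

instance (r s : Row) : Decidable (r.subseg s) := by unfold Row.subseg; infer_instance

/-- A symbol: valid rows, `A_i + B_i ≥ 0`, all `A_i` congruent mod `ℤ`, and the
listed order admissible, i.e. condition (P). -/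
def IsSymbol (E : List Row) : Prop :=
  (∀ r ∈ E, r.IsES) ∧ (∀ r ∈ E, 0 ≤ r.A + r.B) ∧
    (∀ r ∈ E, ∀ s ∈ E, IsInt (r.A - s.A)) ∧
    E.Pairwise (fun r s => ¬ (s.A < r.A ∧ s.B < r.B))

/-- An extended multi-segment datum: a symbol with `0 ≤ l_i ≤ b_i / 2`. -/
def IsEMS (E : List Row) : Prop :=
  IsSymbol E ∧ ∀ r ∈ E, 0 ≤ r.l ∧ r.l ≤ r.b / 2

/-- The listed order satisfies (P'). -/
def Pprime (E : List Row) : Prop := E.Pairwise (fun r s => r.B ≤ s.B)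

/-- Equivalence of extended segments. -/
def Row.Equiv (r s : Row) : Prop :=
  r.A = s.A ∧ r.B = s.B ∧ r.l = s.l ∧ (r.eta = s.eta ∨ r.l = r.b / 2)

/-- Rowwise equivalence of symbols. -/
def SymEquiv (E F : List Row) : Prop := List.Forall₂ Row.Equiv E F

/-- Shift of one row: `[A,B] ↦ [A+d, B+d]`. -/
def Row.sh (r : Row) (d : ℤ) : Row := { r with A := r.A + d, B := r.B + d }

/-- Add on one row: `([A,B],l) ↦ ([A+d, B-d], l+d)`. -/
def Row.addOp (r : Row) (d : ℤ) : Row :=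
  { r with A := r.A + d, B := r.B - d, l := r.l + d }

/-- `sh^d` applied to every row. -/
def shAll (d : ℤ) (E : List Row) : List Row := E.map fun r => r.sh d

/-- The updated pair of rows in a row exchange of rows `r = row k` and `s = row k+1`
(assuming one of the segments contains the other); the first component is the new row
at position `k` (the updated `s`) and the second the new row at position `k+1`
(the updated `r`). -/
def rexPair (r s : Row) : Row × Row :=
  if r.subseg s then
    -- Case `[A_k,B_k] ⊆ [A_{k+1},B_{k+1}]`
    (if m1pow (r.A - r.B) * r.eta * s.eta = 1 then
        if s.b - 2 * s.l < 2 * (r.b - 2 * r.l) then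
          (⟨s.A, s.B, s.b - (s.l + (r.b - 2 * r.l)), m1pow (r.A - r.B) * s.eta⟩ : Row)
        else ⟨s.A, s.B, s.l + (r.b - 2 * r.l), m1pow (r.A - r.B + 1) * s.eta⟩
      else ⟨s.A, s.B, s.l - (r.b - 2 * r.l), m1pow (r.A - r.B + 1) * s.eta⟩,
     ⟨r.A, r.B, r.l, m1pow (s.A - s.B) * r.eta⟩)
  else
    -- Case `[A_{k+1},B_{k+1}] ⊊ [A_k,B_k]`
    (⟨s.A, s.B, s.l, m1pow (r.A - r.B) * s.eta⟩,
     if m1pow (r.A - r.B) * r.eta * s.eta = 1 then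
        if r.b - 2 * r.l < 2 * (s.b - 2 * s.l) then
          (⟨r.A, r.B, r.b - (r.l + (s.b - 2 * s.l)), m1pow (s.A - s.B) * r.eta⟩ : Row)
        else ⟨r.A, r.B, r.l + (s.b - 2 * s.l), m1pow (s.A - s.B + 1) * r.eta⟩
      else ⟨r.A, r.B, r.l - (s.b - 2 * s.l), m1pow (s.A - s.B + 1) * r.eta⟩)

/-- Row exchange `R_k` at positions `k, k+1` (0-indexed). -/
def rex (k : ℕ) (E : List Row) : List Row :=
  match E[k]?, E[k+1]? with
  | some r, some s =>
      if r.subseg s ∨ s.subseg r then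
        E.take k ++ (rexPair r s).1 :: (rexPair r s).2 :: E.drop (k + 2)
      else E
  | _, _ => E

/-- One row exchange step. -/
def ReorderStep (E F : List Row) : Prop := ∃ k, F = rex k E

/-- Admissible reorderings: finite sequences of row exchanges. -/
def Reorder : List Row → List Row → Prop := Relation.ReflTransGen ReorderStep

/-- Coincidence up to row exchanges (in either direction) and rowwise equivalence. -/
def UpToRex (E F : List Row) : Prop :=
  ∃ G, Relation.ReflTransGen (fun X Y => ReorderStep X Y ∨ ReorderStep Y X) E G ∧
    SymEquiv G F

/-- `α_i = ∑_{j<i} (A_j + B_j + 1)`. -/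
def alphaAt (E : List Row) (i : ℕ) : ℚ := ((E.take i).map Row.a).sum

/-- `β_i = ∑_{j>i} (A_j - B_j + 1)`. -/
def betaAt (E : List Row) (i : ℕ) : ℚ := ((E.drop (i + 1)).map Row.b).sum

/-- `γ_i = ∑_{j>i} (A_j + B_j + 1)`. -/
def gammaAt (E : List Row) (i : ℕ) : ℚ := ((E.drop (i + 1)).map Row.a).sum

/-- Condition (∗) of the non-vanishing criterion. -/
def StarCond (E : List Row) : Prop :=
  ∀ i : ℕ, ∀ r : Row, E[i]? = some r →
    (IsInt r.B → 0 ≤ r.B + r.l) ∧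
    (¬ IsInt r.B → r.eta = - m1pow (alphaAt E i) → (1 / 2 : ℚ) ≤ r.B + r.l) ∧
    (¬ IsInt r.B → r.eta = m1pow (alphaAt E i) → -(1 / 2 : ℚ) ≤ r.B + r.l)

/-- Xu's non-vanishing conditions at an adjacent pair of rows `(r, s) = (row k, row k+1)`. -/
def XuPair (r s : Row) : Prop :=
  ((r.A ≤ s.A ∧ r.B ≤ s.B) →
    (m1pow (r.A - r.B) * r.eta * s.eta = 1 →
        r.B + r.l ≤ s.B + s.l ∧ r.A - r.l ≤ s.A - s.l) ∧
    (m1pow (r.A - r.B) * r.eta * s.eta = -1 → r.A - r.l < s.B + s.l)) ∧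
  ((r.subseg s ∧ ¬ s.subseg r) →
    (m1pow (r.A - r.B) * r.eta * s.eta = 1 → 0 ≤ s.l - r.l ∧ s.l - r.l ≤ s.b - r.b) ∧
    (m1pow (r.A - r.B) * r.eta * s.eta = -1 → r.b ≤ r.l + s.l)) ∧
  ((s.subseg r ∧ ¬ r.subseg s) →
    (m1pow (r.A - r.B) * r.eta * s.eta = 1 → 0 ≤ r.l - s.l ∧ r.l - s.l ≤ r.b - s.b) ∧
    (m1pow (r.A - r.B) * r.eta * s.eta = -1 → s.b ≤ r.l + s.l))

/-- Xu's non-vanishing conditions at every adjacent pair of rows. -/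
def XuAll (E : List Row) : Prop := E.Chain' XuPair

/-- The non-vanishing criterion for an extended multi-segment datum. -/
def NonVanishing (E : List Row) : Prop :=
  StarCond E ∧
    ∀ d : ℕ, (∀ r ∈ E, 0 ≤ r.B + (d : ℚ)) →
      ∀ F, Reorder (shAll d E) F → XuAll F

/-- Applicability of a union-intersection at an adjacent pair of rows. -/
def uiApplicablePair (r s : Row) : Prop :=
  r.A < s.A ∧ r.B < s.B ∧
    ((m1pow (r.A - r.B) * r.eta * s.eta = 1 ∧
        (s.A - s.l = r.A - r.l ∨ s.B + s.l = r.B + r.l)) ∨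
      (m1pow (r.A - r.B) * r.eta * s.eta = -1 ∧ s.B + s.l = r.A - r.l + 1))

instance (r s : Row) : Decidable (uiApplicablePair r s) := by
  unfold uiApplicablePair; infer_instance

/-- Type 3' of a union-intersection at an adjacent pair. -/
def uiT3 (r s : Row) : Prop :=
  r.l = 0 ∧ s.l = 0 ∧ m1pow (r.A - r.B) * r.eta * s.eta = -1

instance (r s : Row) : Decidable (uiT3 r s) := by unfold uiT3; infer_instance

/-- The pair of rows produced by a union-intersection at an adjacent applicable pair. -/
def uiPair (r s : Row) : Row × Row :=
  if m1pow (r.A - r.B) * r.eta * s.eta = 1 then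
    if s.A - s.l = r.A - r.l then
      -- Case 1
      ((⟨s.A, r.B, r.l, r.eta⟩ : Row),
       (⟨r.A, s.B, s.l - (s.A - r.A), m1pow (s.A - r.A) * s.eta⟩ : Row))
    else
      -- Case 2
      if s.A - r.A ≤ r.b - 2 * r.l then
        (⟨s.A, r.B, r.l + (s.A - r.A), r.eta⟩,
         ⟨r.A, s.B, s.l, m1pow (s.A - r.A) * s.eta⟩)
      else
        (⟨s.A, r.B, r.b - r.l, - r.eta⟩,
         ⟨r.A, s.B, s.l, m1pow (s.A - r.A) * s.eta⟩)
  else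
    -- Case 3
    if s.l ≤ r.l then
      (⟨s.A, r.B, r.l, r.eta⟩, ⟨r.A, s.B, s.l, m1pow (s.A - r.A) * s.eta⟩)
    else
      (⟨s.A, r.B, r.l, r.eta⟩, ⟨r.A, s.B, r.l, m1pow (s.A - r.A + 1) * s.eta⟩)

/-- Union-intersection at positions `k, k+1` (deleting the second new row in type 3'). -/
def uiAt (k : ℕ) (E : List Row) : List Row :=
  match E[k]?, E[k+1]? with
  | some r, some s =>
      if uiApplicablePair r s then
        if uiT3 r s then
          E.take k ++ (uiPair r s).1 :: E.drop (k + 2)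
        else
          E.take k ++ (uiPair r s).1 :: (uiPair r s).2 :: E.drop (k + 2)
      else E
  | _, _ => E

/-- Minimality: no union-intersection is applicable. -/
def MinimalP (E : List Row) : Prop :=
  ∀ F, Reorder E F → ∀ k r s, F[k]? = some r → F[k+1]? = some s →
    ¬ uiApplicablePair r s

/-- The image of a row under Atobe's dual. -/
def dualRow (E : List Row) (i : ℕ) (r : Row) : Row :=
  let α := alphaAt E i
  let β := betaAt E i
  let η₀ : ℤ := if ¬ IsInt r.B ∧ r.l = r.b / 2 then - m1pow α else r.eta
  if IsInt r.B then
    ⟨r.A, -r.B, r.l + r.B, m1pow (α + β) * η₀⟩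
  else
    ⟨r.A, -r.B, r.l + r.B + ((m1pow α * η₀ : ℤ) : ℚ) / 2, - (m1pow (α + β) * η₀)⟩

/-- Atobe's dual of a symbol whose order satisfies (P'). -/
def dual (E : List Row) : List Row :=
  (E.mapIdx fun i r => dualRow E i r).reverse

/-- Applicability of the partial dual `dual_k^+` at position `k` (0-indexed). -/
def DualPlusApplicable (E : List Row) (k : ℕ) : Prop :=
  ∃ r, E[k]? = some r ∧ r.B = 1 / 2 ∧ r.l = 0 ∧ r.eta = - m1pow (alphaAt E k) ∧
    ∀ i, i < k → ∀ s, E[i]? = some s → s.B < 1 / 2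

/-- The partial dual `dual_k^+` at position `k`. -/
def dualPlus (k : ℕ) (E : List Row) : List Row :=
  match E[k]? with
  | some rk =>
      (dual ((dual E).set (E.length - 1 - k)
          ⟨rk.A, 1 / 2, 0, - m1pow (gammaAt E k)⟩)).take k ++
        (⟨rk.A, -(1 / 2), 0, - rk.eta⟩ : Row) :: E.drop (k + 1)
  | none => E

/-- Applicability of the partial dual `dual_k^-`. -/
def DualMinusApplicable (E : List Row) (k : ℕ) : Prop :=
  DualPlusApplicable (dual E) (E.length - 1 - k)

/-- The partial dual `dual_k^-`. -/
def dualMinus (k : ℕ) (E : List Row) : List Row :=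
  dual (dualPlus (E.length - 1 - k) (dual E))

/-- Maximality: `E` is not, up to row exchanges, the result of a union-intersection
applied to a non-vanishing extended multi-segment datum. -/
def Maximal (E : List Row) : Prop :=
  ¬ ∃ (E'' F : List Row) (k : ℕ) (r s : Row), IsEMS E'' ∧ NonVanishing E'' ∧
      Reorder E'' F ∧ F[k]? = some r ∧ F[k+1]? = some s ∧ uiApplicablePair r s ∧
      UpToRex (uiAt k F) E

/-- Absolute maximality. -/
def AbsolutelyMaximal (E : List Row) : Prop := Maximal E ∧ MinimalP (dual E)

/-- The sign `(-1)^{⌊b/2⌋ + l} * eta^b` of a row. -/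
def rowSign (r : Row) : ℤ :=
  (if (⌊r.b / 2⌋ + ⌊r.l⌋) % 2 = 0 then (1 : ℤ) else -1) * r.eta ^ (⌊r.b⌋.toNat)

/-- The sign product of a symbol. -/
def signProd (E : List Row) : ℤ := (E.map rowSign).prod

/-! ### Labeled symbols: rows carry labels that travel with them under reorderings. -/

/-- A labeled row. -/
abbrev LRow := ℕ × Row

/-- The underlying list of rows of a labeled symbol. -/
def rows (L : List LRow) : List Row := L.map Prod.snd

/-- `sh_i^d`, acting on the row labeled `i`. -/
def shL (i : ℕ) (d : ℤ) (L : List LRow) : List LRow :=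
  L.map fun p => if p.1 = i then (p.1, p.2.sh d) else p

/-- `add_i^d`, acting on the row labeled `i`. -/
def addL (i : ℕ) (d : ℤ) (L : List LRow) : List LRow :=
  L.map fun p => if p.1 = i then (p.1, p.2.addOp d) else p

/-- `sh^d` on a labeled symbol. -/
def shAllL (d : ℤ) (L : List LRow) : List LRow := L.map fun p => (p.1, p.2.sh d)

/-- Row exchange at positions `k, k+1` on a labeled symbol. -/
def rexL (k : ℕ) (L : List LRow) : List LRow :=
  match L[k]?, L[k+1]? with
  | some (a, r), some (c, s) =>
      if r.subseg s ∨ s.subseg r then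
        L.take k ++ (c, (rexPair r s).1) :: (a, (rexPair r s).2) :: L.drop (k + 2)
      else L
  | _, _ => L

/-- One row exchange step on labeled symbols. -/
def ReorderStepL (L M : List LRow) : Prop := ∃ k, M = rexL k L

/-- Admissible reorderings of labeled symbols. -/
def ReorderL : List LRow → List LRow → Prop := Relation.ReflTransGen ReorderStepL

/-- Labelwise equivalence of labeled symbols. -/
def LSymEquiv (L M : List LRow) : Prop :=
  List.Forall₂ (fun p q => p.1 = q.1 ∧ Row.Equiv p.2 q.2) L M

/-- `M` coincides with `L` up to row exchanges and rowwise equivalence (labels forgotten). -/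
def CoincidesUpToRex (L M : List LRow) : Prop :=
  ∃ L', Relation.ReflTransGen (fun X Y => ReorderStepL X Y ∨ ReorderStepL Y X) L L' ∧
    SymEquiv (rows L') (rows M)

/-- Union-intersection at positions `k, k+1` on a labeled symbol. -/
def uiAtL (k : ℕ) (L : List LRow) : List LRow :=
  match L[k]?, L[k+1]? with
  | some (a, r), some (c, s) =>
      if uiApplicablePair r s then
        if uiT3 r s then
          L.take k ++ (a, (uiPair r s).1) :: L.drop (k + 2)
        else
          L.take k ++ (a, (uiPair r s).1) :: (c, (uiPair r s).2) :: L.drop (k + 2)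
      else L
  | _, _ => L

/-- The relation `M = ui_{i,j}(L)`, with a constraint `P` on the adjacent pair used:
some admissible reordering `L'` of `L` puts the row labeled `i` immediately before the
row labeled `j`, `ui` is applicable there, and `M` is obtained from the result by row
exchanges restoring the original relative order of the (surviving) labels. -/
def UIrelWith (P : Row → Row → Prop) (L : List LRow) (i j : ℕ) (M : List LRow) : Prop :=
  ∃ (L' : List LRow) (k : ℕ) (r s : Row),
    ReorderL L L' ∧ L'[k]? = some (i, r) ∧ L'[k+1]? = some (j, s) ∧
    uiApplicablePair r s ∧ P r s ∧
    ReorderL (uiAtL k L') M ∧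
    M.map Prod.fst =
      (L.map Prod.fst).filter fun x => decide (x ∈ (uiAtL k L').map Prod.fst)

/-- The relation `M = ui_{i,j}(L)`. -/
def UIrel (L : List LRow) (i j : ℕ) (M : List LRow) : Prop :=
  UIrelWith (fun _ _ => True) L i j M

/-- Atobe's dual of a labeled symbol. -/
def dualL (L : List LRow) : List LRow :=
  (L.mapIdx fun i p => (p.1, dualRow (rows L) i p.2)).reverse

/-- The partial dual `dual^+` at position `k` on a labeled symbol. -/
def dualPlusL (k : ℕ) (L : List LRow) : List LRow :=
  match L[k]? with
  | some (lab, rk) =>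
      (dualL ((dualL L).set (L.length - 1 - k)
          (lab, ⟨rk.A, 1 / 2, 0, - m1pow (gammaAt (rows L) k)⟩))).take k ++
        (lab, (⟨rk.A, -(1 / 2), 0, - rk.eta⟩ : Row)) :: L.drop (k + 1)
  | none => L

/-- Position of the row labeled `i`. -/
def posOf (L : List LRow) (i : ℕ) : ℕ := L.findIdx fun p => p.1 == i

/-- The partial dual `dual_i^+`, acting at the row labeled `i`. -/
def dualPlusLab (i : ℕ) (L : List LRow) : List LRow := dualPlusL (posOf L i) L

/-- Applicability of `dual_i^+` on a labeled symbol. -/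
def DualPlusApplicableLab (i : ℕ) (L : List LRow) : Prop :=
  i ∈ L.map Prod.fst ∧ DualPlusApplicable (rows L) (posOf L i)

/-- The partial dual `dual_i^-` on a labeled symbol. -/
def dualMinusLab (i : ℕ) (L : List LRow) : List LRow := dualL (dualPlusLab i (dualL L))

/-- Applicability of `dual_i^-` on a labeled symbol. -/
def DualMinusApplicableLab (i : ℕ) (L : List LRow) : Prop :=
  DualPlusApplicableLab i (dualL L)

/-- One basic operator step: a row exchange, a union-intersection, a composition
`dual ∘ ui_{i,j} ∘ dual`, or an inverse of one of these. -/
def BasicStep (L M : List LRow) : Prop :=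
  (∃ k, M = rexL k L) ∨ (∃ k, L = rexL k M) ∨
  (∃ i j, UIrel L i j M) ∨ (∃ i j, UIrel M i j L) ∨
  (∃ i j N, UIrel (dualL L) i j N ∧ M = dualL N) ∨
  (∃ i j N, UIrel (dualL M) i j N ∧ L = dualL N)

/-- Finite sequences of basic operators. -/
def Basic : List LRow → List LRow → Prop := Relation.ReflTransGen BasicStep

/-- Shift every row after position `j` one step to the right. -/
def shAfter (j : ℕ) (E : List Row) : List Row :=
  E.mapIdx fun i r => if j < i then r.sh 1 else r

/-- Shift every row with `B_i ≥ B` one step to the left. -/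
def shiftGE (B : ℚ) (E : List Row) : List Row :=
  E.map fun r => if B ≤ r.B then r.sh (-1) else r

/-- Shift every row with `B_i ≥ 1/2` one step to the left, deleting the rows of the
form `([1/2,1/2], 0, η)`. -/
def shiftHalfDel (E : List Row) : List Row :=
  (E.filter fun r => !decide (r.A = 1 / 2 ∧ r.B = 1 / 2 ∧ r.l = 0)).map
    fun r => if (1 / 2 : ℚ) ≤ r.B then r.sh (-1) else r

/-- The rows `([A-r, -(A-r)-1], ⌊A⌋-r, 1)` for `r = 0, …, ⌊A⌋`. -/
def prefixRows (A : ℚ) : List Row :=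
  (List.range (⌊A⌋.toNat + 1)).map fun r =>
    ⟨A - r, -(A - r) - 1, (⌊A⌋ : ℚ) - r, 1⟩

theorem isInt_iff_exists_intCast (x : ℚ) : IsInt x ↔ ∃ z : ℤ, x = z := by
  constructor
  · intro h
    exact ⟨x.num, (Rat.coe_int_num_of_den_eq_one h).symm⟩
  · rintro ⟨z, rfl⟩
    exact Rat.den_intCast z

theorem m1pow_eq_one_or (x : ℚ) : m1pow x = 1 ∨ m1pow x = -1 := by
  unfold m1pow
  split_ifs <;> simp

theorem m1pow_add {x y : ℚ} (hx : IsInt x) (hy : IsInt y) :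
    m1pow (x + y) = m1pow x * m1pow y := by
  obtain ⟨m, rfl⟩ := (isInt_iff_exists_intCast x).1 hx
  obtain ⟨n, rfl⟩ := (isInt_iff_exists_intCast y).1 hy
  rw [← Int.cast_add]
  simp only [m1pow, Rat.num_intCast]
  rcases Int.emod_two_eq_zero_or_one m with hm | hm <;>
    rcases Int.emod_two_eq_zero_or_one n with hn | hn <;>
    simp [Int.add_emod, hm, hn]

theorem isInt_list_sum {L : List ℚ} (h : ∀ x ∈ L, IsInt x) : IsInt L.sum := by
  induction L with
  | nil => exact (isInt_iff_exists_intCast _).2 ⟨0, by simp⟩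
  | cons x L ih =>
    obtain ⟨m, hm⟩ := (isInt_iff_exists_intCast x).1 (h x (by simp))
    obtain ⟨n, hn⟩ := (isInt_iff_exists_intCast _).1 (ih fun y hy => h y (by simp [hy]))
    exact (isInt_iff_exists_intCast _).2 ⟨m + n, by simp [hm, hn]⟩

theorem Row.IsES.isInt_b {r : Row} (h : r.IsES) : IsInt r.b := by
  obtain ⟨-, -, ⟨n, hn⟩, -⟩ := h
  exact (isInt_iff_exists_intCast _).2 ⟨n + 1, by simp [Row.b, hn]⟩

theorem Row.IsES.isInt_a {r : Row} (h : r.IsES) : IsInt r.a := by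
  obtain ⟨-, hB, ⟨n, hn⟩, -⟩ := h
  obtain ⟨m, hm⟩ := (isInt_iff_exists_intCast _).1 hB
  refine (isInt_iff_exists_intCast _).2 ⟨n + m + 1, ?_⟩
  push_cast
  rw [← hn, ← hm, Row.a]
  ring

theorem isInt_alphaAt {E : List Row} (h : ∀ r ∈ E, r.IsES) (i : ℕ) : IsInt (alphaAt E i) := by
  refine isInt_list_sum fun x hx => ?_
  obtain ⟨r, hr, rfl⟩ := List.mem_map.1 hx
  exact (h r (List.mem_of_mem_take hr)).isInt_a

theorem isInt_betaAt {E : List Row} (h : ∀ r ∈ E, r.IsES) (i : ℕ) : IsInt (betaAt E i) := by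
  refine isInt_list_sum fun x hx => ?_
  obtain ⟨r, hr, rfl⟩ := List.mem_map.1 hx
  exact (h r (List.mem_of_mem_drop hr)).isInt_b

@[simp]
theorem dualRow_A (E : List Row) (i : ℕ) (r : Row) : (dualRow E i r).A = r.A := by
  simp only [dualRow]
  split_ifs <;> rfl

@[simp]
theorem dualRow_B (E : List Row) (i : ℕ) (r : Row) : (dualRow E i r).B = -r.B := by
  simp only [dualRow]
  split_ifs <;> rfl

theorem dualRow_a (E : List Row) (i : ℕ) (r : Row) : (dualRow E i r).a = r.b := by
  simp [Row.a, Row.b, sub_eq_add_neg]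

theorem map_a_dual (E : List Row) : (dual E).map Row.a = (E.map Row.b).reverse := by
  rw [dual, List.map_reverse]
  congr 1
  refine List.ext_getElem (by simp) fun i h₁ h₂ => ?_
  simp [dualRow_a]

theorem getElem?_dual (E : List Row) {i : ℕ} (hi : i < E.length) :
    (dual E)[E.length - 1 - i]? = some (dualRow E i E[i]) := by
  rw [dual, List.getElem?_reverse (by simp; omega)]
  have : E.length - 1 - (E.length - 1 - i) = i := by omega
  simp [this, hi]

/-- The `α`-sums of the dual are the `β`-sums of the original symbol. -/
theorem alphaAt_dual (E : List Row) {i : ℕ} (hi : i < E.length) :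
    alphaAt (dual E) (E.length - 1 - i) = betaAt E i := by
  rw [alphaAt, betaAt, List.map_take, map_a_dual, List.take_reverse, List.sum_reverse,
    List.map_drop, List.length_map]
  congr 2
  omega

theorem not_isInt_neg_half : ¬ IsInt (-(1 / 2)) := by
  norm_num [IsInt]

/-- Characterization of applicability of `dual_k^-`: it is applicable on a
non-vanishing extended multi-segment datum whose order satisfies (P') if and only if
`B_k = -1/2`, `l_k = 0`, and `B_j > -1/2` for every `j > k`. -/
theorem dualMinus_applicable_iff (E : List Row)
    (hE : IsEMS E) (hNV : NonVanishing E) (hP : Pprime E)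
    (k : ℕ) (r : Row) (hr : E[k]? = some r) :
    DualMinusApplicable E k ↔
      (r.B = -(1 / 2) ∧ r.l = 0 ∧
        ∀ m, k < m → ∀ s : Row, E[m]? = some s → -(1 / 2) < s.B) := by
  obtain ⟨hk, rfl⟩ := List.getElem?_eq_some_iff.1 hr
  have hES : ∀ s ∈ E, s.IsES := hE.1.1
  have hadd := m1pow_add (isInt_alphaAt hES k) (isInt_betaAt hES k)
  have hlater : (∀ i, i < E.length - 1 - k → ∀ s, (dual E)[i]? = some s → s.B < 1 / 2) ↔
      ∀ m, k < m → ∀ s : Row, E[m]? = some s → -(1 / 2) < s.B := by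
    constructor
    · intro h m hm s hs
      obtain ⟨hmE, rfl⟩ := List.getElem?_eq_some_iff.1 hs
      have := h _ (by omega) _ (getElem?_dual E hmE)
      rw [dualRow_B] at this
      linarith
    · intro h i hi s hs
      have hm : E.length - 1 - i < E.length := by omega
      have hd := getElem?_dual E hm
      rw [show E.length - 1 - (E.length - 1 - i) = i by omega, hs] at hd
      have := h _ (by omega) _ (List.getElem?_eq_getElem hm)
      rw [Option.some.inj hd, dualRow_B]
      linarith
  simp only [DualMinusApplicable, DualPlusApplicable, getElem?_dual E hk, Option.some.injEq,
    exists_eq_left', alphaAt_dual E hk, hlater, dualRow_B]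
  rw [← and_assoc, ← and_assoc, ← and_assoc, and_congr_left_iff, and_assoc, neg_eq_iff_eq_neg,
    and_congr_right_iff]
  intro _ hB
  have hint : ¬ IsInt E[k].B := hB ▸ not_isInt_neg_half
  have hα := m1pow_eq_one_or (alphaAt E k)
  have hβ := m1pow_eq_one_or (betaAt E k)
  obtain ⟨-, -, ⟨n, hn⟩, -, hη⟩ := hES _ (List.getElem_mem hk)
  have hb : 0 < E[k].b := by
    rw [Row.b, hn]
    positivity
  simp only [dualRow, hint, not_false_eq_true, true_and, if_false, hadd]
  constructor
  · rintro ⟨hl, he⟩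
    generalize (if E[k].l = E[k].b / 2 then -m1pow (alphaAt E k) else E[k].eta) = e at hl he
    have hs : m1pow (alphaAt E k) * e = 1 := by
      rcases hα with h | h <;> rcases hβ with h' | h' <;> rw [h, h'] at he <;> rw [h] <;> omega
    rw [hs, hB] at hl
    push_cast at hl
    linarith
  · intro hl
    have hne : E[k].l ≠ E[k].b / 2 := by
      rw [hl]
      linarith
    have hstar := (hNV.1 k _ hr).2.1 hint
    have hs : E[k].eta = m1pow (alphaAt E k) := by
      by_contra hcon
      have := hstar (by omega)
      rw [hB, hl] at this
      norm_num at this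
    rw [if_neg hne, hs, hB, hl]
    rcases hα with h | h <;> rw [h] <;> norm_num

end LocalArthur
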